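/- Let {k_u} be a degree sequence on a finite vertex set V of size n such that for every vertex v, k_v − (n−1) is nonnegative and even. Then the multiloop-graph K consisting of all n(n−1)/2 non-loop edges of the complete graph on V together with (k_v − (n−1))/2 self-loops at each vertex v has degree sequence {k_u}, and no double edge swap applied to K produces a multiloop-graph (every such swap creates a multiedge). Consequently K is an isolated vertex of G_ll({k_u}), and if there exists any other multiloop-graph with degree sequence {k_u}, then G_ll({k_u}) is disconnected. -/

import Mathlib

/-!
Multiset-based graphs: a graph on `V` is a multiset of unordered pairs (`Sym2 V`).
-/

variable {V : Type*}

/-- Degree of `u`: number of edge-endpoints at `u` (a self-loop at `u` contributes 2). -/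
def mDeg [DecidableEq V] (E : Multiset (Sym2 V)) (u : V) : ℕ :=
  (E.map fun e => if e = s(u, u) then 2 else if u ∈ e then 1 else 0).sum

/-- Loopy-multigraph: every self-loop occurs with multiplicity at most 1
(non-loop pairs may repeat). -/
def IsLoopyMultigraph [DecidableEq V] (E : Multiset (Sym2 V)) : Prop :=
  ∀ u : V, E.count s(u, u) ≤ 1

/-- Multiloop-graph: every non-loop pair occurs with multiplicity at most 1
(self-loops may repeat). -/
def IsMultiloopGraph [DecidableEq V] (E : Multiset (Sym2 V)) : Prop :=
  ∀ u v : V, u ≠ v → E.count s(u, v) ≤ 1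

/-- Double edge swap: remove edges `(u,v)`, `(x,y)` (counted with multiplicity),
add the edges `(u,x)`, `(v,y)`. -/
def DoubleEdgeSwap [DecidableEq V] (E E' : Multiset (Sym2 V)) : Prop :=
  ∃ u v x y : V, ({s(u, v), s(x, y)} : Multiset (Sym2 V)) ≤ E ∧
    E' = E - {s(u, v), s(x, y)} + {s(u, x), s(v, y)}

/-- Adjacency in the graph of graphs on the space of graphs satisfying `P`:
both graphs lie in the space and one is obtained from the other by a single double edge swap. -/
def GogAdj [DecidableEq V] (P : Multiset (Sym2 V) → Prop) (E E' : Multiset (Sym2 V)) : Prop :=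
  P E ∧ P E' ∧ (DoubleEdgeSwap E E' ∨ DoubleEdgeSwap E' E)

/-- The space of loopy-multigraphs with degree sequence `k`. -/
def LMGspace [DecidableEq V] (k : V → ℕ) (E : Multiset (Sym2 V)) : Prop :=
  IsLoopyMultigraph E ∧ ∀ u, mDeg E u = k u

/-- The space of multiloop-graphs with degree sequence `k`. -/
def MLGspace [DecidableEq V] (k : V → ℕ) (E : Multiset (Sym2 V)) : Prop :=
  IsMultiloopGraph E ∧ ∀ u, mDeg E u = k u

/-- Number of self-loops of `E` (counted with multiplicity). -/
def loopCount [DecidableEq V] (E : Multiset (Sym2 V)) : ℕ :=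
  (E.filter fun e => e.IsDiag).card

/-- An open wedge: non-loop edges `(u,v)`, `(u,x)` with `v ≠ x` such that `(v,x)` is not
an edge. -/
def HasOpenWedge [DecidableEq V] (E : Multiset (Sym2 V)) : Prop :=
  ∃ u v x : V, u ≠ v ∧ u ≠ x ∧ v ≠ x ∧ s(u, v) ∈ E ∧ s(u, x) ∈ E ∧ s(v, x) ∉ E

/-- The multiloop-graph consisting of all non-loop edges of the complete graph on `V`
together with `(k v - (n-1))/2` self-loops at each vertex `v`. -/
def completePlusLoops (V : Type*) [Fintype V] [DecidableEq V] (k : V → ℕ) :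
    Multiset (Sym2 V) :=
  ((Finset.univ : Finset (Sym2 V)).filter fun e => ¬ e.IsDiag).val +
    ∑ v : V, Multiset.replicate ((k v - (Fintype.card V - 1)) / 2) s(v, v)

theorem mDeg_add [DecidableEq V] (E F : Multiset (Sym2 V)) (u : V) :
    mDeg (E + F) u = mDeg E u + mDeg F u := by
  simp [mDeg]

theorem mDeg_replicate_loop [DecidableEq V] (m : ℕ) (v u : V) :
    mDeg (Multiset.replicate m s(v, v)) u = if v = u then 2 * m else 0 := by
  by_cases h : v = u
  · simp [mDeg, h, mul_comm]
  · simp [mDeg, h, Ne.symm h]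

theorem mDeg_sum [DecidableEq V] {ι : Type*} (s : Finset ι) (f : ι → Multiset (Sym2 V)) (u : V) :
    mDeg (∑ i ∈ s, f i) u = ∑ i ∈ s, mDeg (f i) u := by
  classical
  induction s using Finset.induction_on with
  | empty => simp [mDeg]
  | insert a s ha ih => rw [Finset.sum_insert ha, Finset.sum_insert ha, mDeg_add, ih]

/-- In the complete graph every vertex has degree `n - 1`. -/
theorem mDeg_not_isDiag [Fintype V] [DecidableEq V] (u : V) :
    mDeg ((Finset.univ : Finset (Sym2 V)).filter fun e => ¬ e.IsDiag).val u =
      Fintype.card V - 1 := by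
  have h : ((Finset.univ : Finset (Sym2 V)).filter fun e => ¬ e.IsDiag).filter (u ∈ ·) =
      (Finset.univ.erase u).image fun w => s(u, w) := by
    ext e
    induction e with
    | _ a b =>
    simp only [Finset.mem_filter, Finset.mem_univ, true_and, Sym2.mk_isDiag_iff,
      Sym2.mem_iff, Finset.mem_image, Finset.mem_erase, and_true, Sym2.eq_iff]
    constructor
    · rintro ⟨hab, rfl | rfl⟩
      · exact ⟨b, Ne.symm hab, by simp⟩
      · exact ⟨a, hab, by simp⟩
    · grind
  calc mDeg ((Finset.univ : Finset (Sym2 V)).filter fun e => ¬ e.IsDiag).val u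
      = ∑ e ∈ (Finset.univ : Finset (Sym2 V)).filter fun e => ¬ e.IsDiag,
          if u ∈ e then 1 else 0 := by
        refine Finset.sum_congr rfl fun e he => if_neg ?_
        rintro rfl
        simp at he
    _ = Fintype.card V - 1 := by
        rw [← Finset.card_filter, h,
          Finset.card_image_of_injective _ fun _ _ => Sym2.congr_right.1,
          Finset.card_erase_of_mem (Finset.mem_univ u), Finset.card_univ]

theorem count_completePlusLoops [Fintype V] [DecidableEq V] (k : V → ℕ) {u v : V} (h : u ≠ v) :
    (completePlusLoops V k).count s(u, v) = 1 := by
  have hloop : ∀ w : V, s(w, w) ≠ s(u, v) := by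
    intro w hw
    rw [Sym2.eq_iff] at hw
    grind
  rw [completePlusLoops, Multiset.count_add, Multiset.count_sum',
    Multiset.count_eq_one_of_mem (Finset.nodup _) (by simpa using h)]
  simp [Multiset.count_replicate, hloop]

theorem mDeg_completePlusLoops [Fintype V] [DecidableEq V] {k : V → ℕ} {v : V}
    (hle : Fintype.card V - 1 ≤ k v) (heven : Even (k v - (Fintype.card V - 1))) :
    mDeg (completePlusLoops V k) v = k v := by
  rw [completePlusLoops, mDeg_add, mDeg_not_isDiag, mDeg_sum]
  simp only [mDeg_replicate_loop, Finset.sum_ite_eq', Finset.mem_univ, if_true]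
  rw [Nat.two_mul_div_two_of_even heven]
  omega

theorem DoubleEdgeSwap.symm [DecidableEq V] {E E' : Multiset (Sym2 V)}
    (h : DoubleEdgeSwap E E') : DoubleEdgeSwap E' E := by
  obtain ⟨u, v, x, y, hle, rfl⟩ := h
  refine ⟨u, x, v, y, Multiset.le_add_left _ _, ?_⟩
  rw [Multiset.add_sub_cancel_right, Multiset.sub_add_cancel hle]

/-- A multiloop-graph containing every non-loop edge is fixed by every double edge swap that
stays among multiloop-graphs. -/
theorem DoubleEdgeSwap.eq_of_count_eq_one [DecidableEq V] {E E' : Multiset (Sym2 V)}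
    (hE : ∀ u v : V, u ≠ v → E.count s(u, v) = 1) (h : DoubleEdgeSwap E E')
    (hE' : IsMultiloopGraph E') : E' = E := by
  obtain ⟨u, v, x, y, hle, rfl⟩ := h
  suffices hs : ({s(u, x), s(v, y)} : Multiset (Sym2 V)) = {s(u, v), s(x, y)} by
    rw [hs, Multiset.sub_add_cancel hle]
  have key : ∀ a b : V, a ≠ b → s(a, b) ∈ ({s(u, x), s(v, y)} : Multiset (Sym2 V)) →
      s(a, b) ∈ ({s(u, v), s(x, y)} : Multiset (Sym2 V)) := by
    intro a b hab hmem
    by_contra hn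
    have h1 := hE' a b hab
    rw [Multiset.count_add, Multiset.count_sub, hE a b hab,
      Multiset.count_eq_zero_of_notMem hn] at h1
    have := Multiset.count_pos.2 hmem
    omega
  by_cases hux : u = x
  · subst hux
    by_cases hvy : v = y
    · subst hvy
      by_cases huv : u = v
      · rw [huv]
      · have h2 := Multiset.count_le_of_le s(u, v) hle
        rw [hE u v huv] at h2
        simp at h2
    · have h2 := key v y hvy (by simp)
      simp only [Multiset.insert_eq_cons, Multiset.mem_cons, Multiset.mem_singleton,
        Sym2.eq_iff] at h2
      obtain rfl | rfl : u = y ∨ u = v := by grind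
      · rw [Multiset.pair_comm, Sym2.eq_swap]
      · rfl
  · have h2 := key u x hux (by simp)
    simp only [Multiset.insert_eq_cons, Multiset.mem_cons, Multiset.mem_singleton,
      Sym2.eq_iff] at h2
    obtain rfl | rfl : x = v ∨ u = y := by grind
    · rfl
    · rw [Multiset.pair_comm, Sym2.eq_swap (a := v), Sym2.eq_swap (a := u) (b := x)]

/-- if every `k v - (n-1)` is nonnegative and even, the complete graph plus
loops `K` is a multiloop-graph with degree sequence `k`; no double edge swap applied to `K`
produces a multiloop-graph (other than `K` itself), so `K` is isolated in the gog; hence if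
any other realization exists the gog is disconnected. -/
theorem completePlusLoops_isolated {V : Type*} [Fintype V] [DecidableEq V]
    (k : V → ℕ) (hcond : ∀ v, Fintype.card V - 1 ≤ k v ∧ Even (k v - (Fintype.card V - 1))) :
    IsMultiloopGraph (completePlusLoops V k) ∧
      (∀ v, mDeg (completePlusLoops V k) v = k v) ∧
      (∀ E' : Multiset (Sym2 V), DoubleEdgeSwap (completePlusLoops V k) E' →
        IsMultiloopGraph E' → E' = completePlusLoops V k) ∧
      ((∃ E' : Multiset (Sym2 V), MLGspace k E' ∧ E' ≠ completePlusLoops V k) →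
        ∃ E' : Multiset (Sym2 V), MLGspace k E' ∧
          ¬ Relation.ReflTransGen (GogAdj (MLGspace k)) (completePlusLoops V k) E') := by
  have hiso : ∀ E' : Multiset (Sym2 V), DoubleEdgeSwap (completePlusLoops V k) E' →
      IsMultiloopGraph E' → E' = completePlusLoops V k := fun E' h hE' =>
    h.eq_of_count_eq_one (fun _ _ => count_completePlusLoops k) hE'
  refine ⟨fun u v h => (count_completePlusLoops k h).le,
    fun v => mDeg_completePlusLoops (hcond v).1 (hcond v).2, hiso, ?_⟩
  rintro ⟨E', hE', hne⟩
  refine ⟨E', hE', fun hr => hne ?_⟩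
  clear hE' hne
  induction hr with
  | refl => rfl
  | tail _ hadj ih =>
    subst ih
    exact hiso _ (hadj.2.2.elim id DoubleEdgeSwap.symm) hadj.2.1.1
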